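/- Consider the RanSwitch process driven by i.i.d. random offsets: let (X_t)_{t∈ℕ} be independent random variables, each taking the value 0 with probability p and each value m ∈ {1, …, k−1} with probability q. Run the RanSwitch process with offsets x_t = X_t. Then for every index i ≥ k−1 and every integer j with 1−k ≤ j ≤ k−1, the probability that the value originally at position i is released at time i+j (i.e., Pr[R_{i+j} = i]) equals p·(1−q)^{k−1} if j = 0, and q·(1−q)^{k−1+j} if j ≠ 0. -/

import Mathlib

open MeasureTheory ProbabilityTheory

/-- The RanSwitch process: `ranSwitchA x t` is the bijection `A_t : ℕ → ℕ` recording, for each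
slot, the original position of the value currently there. `A_0 = id` and `A_{t+1}` is obtained
from `A_t` by swapping the entries at positions `t` and `t + x t`. -/
def ranSwitchA (x : ℕ → ℕ) : ℕ → ℕ → ℕ
  | 0 => id
  | t + 1 => fun s => ranSwitchA x t (Equiv.swap t (t + x t) s)

/-- The output of the RanSwitch process at time `t`: the original position of the value released
at time `t`, i.e. `R_t = A_t (t + x t)`. -/
def ranSwitchR (x : ℕ → ℕ) (t : ℕ) : ℕ := ranSwitchA x t (t + x t)

/-- The slot that holds the value originally at position `i` just before time `t`. -/
def ranSwitchPos (x : ℕ → ℕ) (i : ℕ) : ℕ → ℕ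
  | 0 => i
  | t + 1 => Equiv.swap t (t + x t) (ranSwitchPos x i t)

lemma ranSwitchA_eq_iff (x : ℕ → ℕ) (i t s : ℕ) :
    ranSwitchA x t s = i ↔ s = ranSwitchPos x i t := by
  induction t generalizing s with
  | zero => rfl
  | succ t ih =>
    simp only [ranSwitchA, ranSwitchPos, ih]
    rw [← Equiv.symm_apply_eq, Equiv.symm_swap, eq_comm]

lemma ranSwitchR_eq_iff (x : ℕ → ℕ) (i t : ℕ) :
    ranSwitchR x t = i ↔ t + x t = ranSwitchPos x i t :=
  ranSwitchA_eq_iff x i t _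

lemma ranSwitchPos_congr {x y : ℕ → ℕ} (i t : ℕ) (h : ∀ s < t, x s = y s) :
    ranSwitchPos x i t = ranSwitchPos y i t := by
  induction t with
  | zero => rfl
  | succ t ih =>
    simp only [ranSwitchPos]
    rw [ih fun s hs => h s (by omega), h t (by omega)]

lemma ranSwitchPos_succ_eq_iff (x : ℕ → ℕ) (i t d : ℕ) :
    ranSwitchPos x i (t + 1) = t + 1 + d ↔
      (ranSwitchPos x i t = t ∧ x t = d + 1) ∨
        (ranSwitchPos x i t = t + (d + 1) ∧ ¬ x t = d + 1) := by
  simp only [ranSwitchPos, Equiv.swap_apply_def]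
  split_ifs <;> omega

/-- The offset law of RanSwitch, as a function on `ℕ`. -/
noncomputable def ranSwitchOffsetProb (k : ℕ) (p q : ℝ) (d : ℕ) : ℝ :=
  if d = 0 then p else if d ≤ k - 1 then q else 0

section Recursion

variable {k : ℕ} {p q : ℝ} {V : ℕ → ℕ → ℝ} {i : ℕ}

lemma ranSwitch_recursion_of_le
    (h0 : ∀ d, V 0 d = if d = i then 1 else 0)
    (hV : ∀ t d, V (t + 1) d = V t 0 * ranSwitchOffsetProb k p q (d + 1) +
      V t (d + 1) * (1 - ranSwitchOffsetProb k p q (d + 1)))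
    (t : ℕ) (ht : t ≤ i) (d : ℕ) :
    V t d = if t + d = i then (1 - q) ^ (t - (i - (k - 1))) else 0 := by
  induction t generalizing d with
  | zero => simp [h0]
  | succ t ih =>
    rw [hV, ih (by omega), ih (by omega), if_neg (by omega), zero_mul, zero_add]
    by_cases hd : t + 1 + d = i
    · rw [if_pos hd, if_pos (by omega), ranSwitchOffsetProb, if_neg (by omega)]
      split_ifs with hk
      · rw [← pow_succ]
        congr 1
        omega
      · rw [sub_zero, mul_one]
        congr 1
        omega
    · rw [if_neg hd, if_neg (by omega), zero_mul]

lemma sum_range_mul_ranSwitchOffsetProb (hk : 2 ≤ k) (f : ℕ → ℝ) :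
    ∑ d ∈ Finset.range k, f d * ranSwitchOffsetProb k p q d =
      p * f 0 + q * (∑ d ∈ Finset.range k, f d - f 0) := by
  obtain ⟨n, rfl⟩ : ∃ n, k = n + 1 := ⟨k - 1, by omega⟩
  rw [Finset.sum_range_succ', Finset.sum_range_succ', add_sub_cancel_right, Finset.mul_sum,
    add_comm]
  congr 1
  · simp [ranSwitchOffsetProb, mul_comm]
  · refine Finset.sum_congr rfl fun d hd => ?_
    have := Finset.mem_range.1 hd
    rw [ranSwitchOffsetProb, if_neg (by omega), if_pos (by omega), mul_comm]

lemma ranSwitch_recursion_of_lt (hk : 2 ≤ k) (hpq : p + (k - 1 : ℝ) * q = 1) (hi : k - 1 ≤ i)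
    (h0 : ∀ d, V 0 d = if d = i then 1 else 0)
    (hV : ∀ t d, V (t + 1) d = V t 0 * ranSwitchOffsetProb k p q (d + 1) +
      V t (d + 1) * (1 - ranSwitchOffsetProb k p q (d + 1)))
    (j : ℕ) (hj : j + 1 ≤ k - 1) :
    (∀ d, d + j + 1 ≤ k - 1 → V (i + 1 + j) d = (1 - q) ^ (k - 1) * q) ∧
    (∀ d, k - 1 ≤ d → V (i + 1 + j) d = 0) ∧
    ∑ d ∈ Finset.range k, V (i + 1 + j) d =
      (1 - q) ^ (k - 1) * ((1 - q) ^ (j + 1) + q - p) := by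
  have hP1 : ∀ d, d + 1 ≤ k - 1 → ranSwitchOffsetProb k p q (d + 1) = q := fun d hd => by
    rw [ranSwitchOffsetProb, if_neg (by omega), if_pos hd]
  have hP2 : ∀ d, k - 1 ≤ d → ranSwitchOffsetProb k p q (d + 1) = 0 := fun d hd => by
    rw [ranSwitchOffsetProb, if_neg (by omega), if_neg (by omega)]
  have hsum : ∀ t, (∀ d, k ≤ d → V t d = 0) → ∑ d ∈ Finset.range k, V (t + 1) d =
      (1 - p) * V t 0 + (1 - q) * (∑ d ∈ Finset.range k, V t d - V t 0) := by
    intro t ht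
    obtain ⟨n, rfl⟩ : ∃ n, k = n + 1 := ⟨k - 1, by omega⟩
    rw [Finset.sum_range_succ, Finset.sum_range_succ' (fun d => V t d), add_sub_cancel_right,
      hV t n, hP2 n (by omega), ht _ le_rfl,
      Finset.sum_congr rfl (g := fun d => V t 0 * q + V t (d + 1) * (1 - q))
        fun d hd => by rw [hV, hP1 d (by have := Finset.mem_range.1 hd; omega)],
      Finset.sum_add_distrib, Finset.sum_const, ← Finset.sum_mul, Finset.card_range]
    push_cast at hpq
    simp only [nsmul_eq_mul]
    linear_combination V t 0 * hpq
  have hVi : ∀ d, V i d = if d = 0 then (1 - q) ^ (k - 1) else 0 := fun d => by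
    rw [ranSwitch_recursion_of_le h0 hV i le_rfl, show i - (i - (k - 1)) = k - 1 by omega]
    simp
  induction j with
  | zero =>
    refine ⟨fun d hd => ?_, fun d hd => ?_, ?_⟩
    · rw [add_zero, hV, hP1 d hd, hVi, hVi]
      simp
    · rw [add_zero, hV, hP2 d hd, hVi, hVi]
      simp
    · rw [add_zero, hsum i fun d hd => by rw [hVi, if_neg (by omega)]]
      simp only [hVi, Finset.sum_ite_eq', Finset.mem_range, if_pos (show 0 < k by omega), if_true]
      ring
  | succ j ih =>
    obtain ⟨ih1, ih2, ih3⟩ := ih (by omega)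
    rw [← add_assoc (i + 1) j 1]
    refine ⟨fun d hd => ?_, fun d hd => ?_, ?_⟩
    · rw [hV, hP1 d (by omega), ih1 0 (by omega), ih1 (d + 1) (by omega)]
      ring
    · rw [hV, hP2 d hd, ih2 (d + 1) (by omega)]
      simp
    · rw [hsum _ fun d hd => ih2 d (by omega), ih3, ih1 0 (by omega)]
      ring

lemma ranSwitch_recursion_release (hk : 2 ≤ k)
    (hpq : p + (k - 1 : ℝ) * q = 1) (hi : k - 1 ≤ i)
    (h0 : ∀ d, V 0 d = if d = i then 1 else 0)
    (hV : ∀ t d, V (t + 1) d = V t 0 * ranSwitchOffsetProb k p q (d + 1) +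
      V t (d + 1) * (1 - ranSwitchOffsetProb k p q (d + 1)))
    (j : ℤ) (hj1 : 1 - (k : ℤ) ≤ j) (hj2 : j ≤ (k : ℤ) - 1) :
    ∑ d ∈ Finset.range k, V (i + j).toNat d * ranSwitchOffsetProb k p q d =
      if j = 0 then p * (1 - q) ^ (k - 1) else q * (1 - q) ^ ((k : ℤ) - 1 + j) := by
  have hexp : (1 - q) ^ ((k : ℤ) - 1 + j) = (1 - q) ^ ((k : ℤ) - 1 + j).toNat := by
    rw [← zpow_natCast, Int.toNat_of_nonneg (by omega)]
  rw [hexp]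
  rcases le_or_gt j 0 with hj | hj
  · have hd : ∀ d, V (i + j).toNat d =
        if d = (-j).toNat then (1 - q) ^ ((k : ℤ) - 1 + j).toNat else 0 := fun d => by
      rw [ranSwitch_recursion_of_le h0 hV _ (by omega)]
      congr 1
      · simp only [eq_iff_iff]
        omega
      · congr 1
        omega
    simp only [hd, ite_mul, zero_mul, Finset.sum_ite_eq', Finset.mem_range]
    rw [if_pos (by omega), ranSwitchOffsetProb]
    split_ifs with h1 h2 h2 h3 h3
    any_goals omega
    · rw [mul_comm, show ((k : ℤ) - 1 + j).toNat = k - 1 by omega]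
    · rw [mul_comm]
  · obtain ⟨n, rfl⟩ : ∃ n : ℕ, j = n + 1 := ⟨(j - 1).toNat, by omega⟩
    obtain ⟨h1, -, h3⟩ := ranSwitch_recursion_of_lt hk hpq hi h0 hV n (by omega)
    rw [show ((i : ℤ) + (n + 1)).toNat = i + 1 + n by omega,
      sum_range_mul_ranSwitchOffsetProb hk, h3, h1 0 (by omega), if_neg (by omega),
      show ((k : ℤ) - 1 + (n + 1)).toNat = (k - 1) + (n + 1) by omega, pow_add]
    ring

end Recursion

section Probability

variable {Ω : Type*} [MeasurableSpace Ω] {μ : Measure Ω} {X : ℕ → Ω → ℕ}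

lemma measurable_ranSwitchPos (hmeas : ∀ t, Measurable (X t)) (i t : ℕ) :
    Measurable fun ω => ranSwitchPos (fun t => X t ω) i t := by
  induction t with
  | zero => exact measurable_const
  | succ t ih =>
    have h : Measurable fun a : ℕ × ℕ => Equiv.swap t (t + a.1) a.2 := .of_discrete
    exact h.comp ((hmeas t).prodMk ih)

lemma indepFun_ranSwitchPos (hmeas : ∀ t, Measurable (X t)) (hindep : iIndepFun X μ)
    (i t : ℕ) :
    IndepFun (fun ω => ranSwitchPos (fun t => X t ω) i t) (X t) μ := by
  have h := hindep.indepFun_finset (Finset.range t) {t} (by simp) hmeas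
  let f : (Finset.range t → ℕ) → ℕ := fun y =>
    ranSwitchPos (fun s => if hs : s ∈ Finset.range t then y ⟨s, hs⟩ else 0) i t
  let g : (({t} : Finset ℕ) → ℕ) → ℕ := fun y => y ⟨t, by simp⟩
  have hfg := h.comp (φ := f) (ψ := g) .of_discrete .of_discrete
  have hf : (fun ω => ranSwitchPos (fun t => X t ω) i t) =
      f ∘ fun ω (s : Finset.range t) => X s ω := by
    ext ω
    refine ranSwitchPos_congr i t fun s hs => ?_
    simp [hs]
  rw [hf]
  exact hfg

lemma measureReal_ranSwitchPos_inter (hmeas : ∀ t, Measurable (X t)) (hindep : iIndepFun X μ)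
    (i t a : ℕ) (S : Set ℕ) :
    μ.real ({ω | ranSwitchPos (fun t => X t ω) i t = a} ∩ X t ⁻¹' S) =
      μ.real {ω | ranSwitchPos (fun t => X t ω) i t = a} * μ.real (X t ⁻¹' S) := by
  have h := (indepFun_ranSwitchPos hmeas hindep i t).measure_inter_preimage_eq_mul {a} S
    .of_discrete .of_discrete
  have hreal := congrArg ENNReal.toReal h
  rwa [ENNReal.toReal_mul] at hreal

end Probability

/-- allocating probability distribution of RanSwitch, Theorem 1:
if the offsets are i.i.d. with `Pr[X_t = 0] = p` and `Pr[X_t = m] = q` for `1 ≤ m ≤ k-1`,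
then for every `i ≥ k-1` and every `1-k ≤ j ≤ k-1`, the probability that the value originally
at position `i` is released at time `i+j` equals `p (1-q)^{k-1}` if `j = 0`, and
`q (1-q)^{k-1+j}` otherwise. -/
theorem ranSwitch_allocating_probability
    (k : ℕ) (hk : 2 ≤ k) (p q : ℝ)
    (hp : p ∈ Set.Ioo (0 : ℝ) 1) (hq : q ∈ Set.Ioo (0 : ℝ) 1)
    (hpq : p + (k - 1 : ℝ) * q = 1)
    {Ω : Type*} [MeasurableSpace Ω] (μ : Measure Ω) [IsProbabilityMeasure μ]
    (X : ℕ → Ω → ℕ)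
    (hmeas : ∀ t, Measurable (X t))
    (hindep : iIndepFun X μ)
    (hrange : ∀ t ω, X t ω ≤ k - 1)
    (hX0 : ∀ t, μ {ω | X t ω = 0} = ENNReal.ofReal p)
    (hXm : ∀ t m, 1 ≤ m → m ≤ k - 1 → μ {ω | X t ω = m} = ENNReal.ofReal q)
    (i : ℕ) (hi : k - 1 ≤ i) (j : ℤ) (hj1 : 1 - (k : ℤ) ≤ j) (hj2 : j ≤ (k : ℤ) - 1) :
    μ {ω | ranSwitchR (fun t => X t ω) ((i + j).toNat) = i}
      = ENNReal.ofReal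
          (if j = 0 then p * (1 - q) ^ (k - 1) else q * (1 - q) ^ ((k : ℤ) - 1 + j)) := by
  set P := ranSwitchOffsetProb k p q with hP
  have hXP : ∀ t d, μ.real (X t ⁻¹' {d}) = P d := by
    intro t d
    change (μ {ω | X t ω = d}).toReal = P d
    rw [hP, ranSwitchOffsetProb]
    split_ifs with h1 h2
    · rw [h1, hX0, ENNReal.toReal_ofReal hp.1.le]
    · rw [hXm t d (by omega) h2, ENNReal.toReal_ofReal hq.1.le]
    · have : {ω | X t ω = d} = ∅ :=
        Set.eq_empty_of_forall_notMem fun ω hω => h2 (hω ▸ hrange t ω)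
      simp [this]
  let E : ℕ → ℕ → Set Ω := fun t a => {ω | ranSwitchPos (fun t => X t ω) i t = a}
  have hE : ∀ t a, MeasurableSet (E t a) := fun t a =>
    measurable_ranSwitchPos hmeas i t (measurableSet_singleton a)
  have h0 : ∀ d, μ.real (E 0 (0 + d)) = if d = i then 1 else 0 := by
    intro d
    by_cases h : d = i <;> simp [E, ranSwitchPos, h, eq_comm]
  have hV : ∀ t d, μ.real (E (t + 1) (t + 1 + d)) = μ.real (E t (t + 0)) * P (d + 1) +
      μ.real (E t (t + (d + 1))) * (1 - P (d + 1)) := by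
    intro t d
    have hset : E (t + 1) (t + 1 + d) = (E t (t + 0) ∩ X t ⁻¹' {d + 1}) ∪
        (E t (t + (d + 1)) ∩ X t ⁻¹' {d + 1}ᶜ) :=
      Set.ext fun ω => ranSwitchPos_succ_eq_iff _ i t d
    rw [hset, measureReal_union _ ((hE _ _).inter (hmeas t .of_discrete)),
      measureReal_ranSwitchPos_inter hmeas hindep, measureReal_ranSwitchPos_inter hmeas hindep,
      Set.preimage_compl, probReal_compl_eq_one_sub (hmeas t .of_discrete), hXP]
    exact Set.disjoint_left.2 fun ω h1 h2 => h2.2 h1.2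
  have hrel : ∀ t, μ.real {ω | ranSwitchR (fun t => X t ω) t = i} =
      ∑ d ∈ Finset.range k, μ.real (E t (t + d)) * P d := by
    intro t
    have hset : {ω | ranSwitchR (fun t => X t ω) t = i} =
        ⋃ d ∈ Finset.range k, E t (t + d) ∩ X t ⁻¹' {d} := by
      ext ω
      have := hrange t ω
      simp only [Set.mem_ofPred_eq, ranSwitchR_eq_iff, Set.mem_iUnion, Finset.mem_range, E,
        Set.mem_inter_iff, Set.mem_preimage, Set.mem_singleton_iff, exists_prop]
      constructor
      · exact fun h => ⟨X t ω, by omega, h.symm, rfl⟩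
      · rintro ⟨d, -, h, rfl⟩
        exact h.symm
    rw [hset, measureReal_biUnion_finset _ fun d _ => (hE _ _).inter (hmeas t .of_discrete)]
    · refine Finset.sum_congr rfl fun d _ => ?_
      rw [measureReal_ranSwitchPos_inter hmeas hindep, hXP]
    · exact fun a _ b _ hab => Set.disjoint_left.2 fun ω h1 h2 => hab (h1.2.symm.trans h2.2)
  rw [← ENNReal.ofReal_toReal (measure_ne_top μ _)]
  congr 1
  exact (hrel _).trans <|
    ranSwitch_recursion_release (V := fun t d => μ.real (E t (t + d))) hk hpq hi h0 hV j
      hj1 hj2
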